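/- arXiv:1404.7053 — 2 statements merged into one kernel-verified Lean document; each statement's English description precedes it below -/
import Mathlib

section
/- An exponential modulus of uniform continuity suffices for F: there exists a natural number N such that for all n ≥ N and all x, y ∈ [0,1], if |x − y| ≤ 2^{−2^n} then |F(x) − F(y)| ≤ 2^{−n}. -/
open scoped BigOperators

/-- The piecewise linear "step" function `β_{p,q}` on `[0,1]`. -/
noncomputable def beta (p q : ℕ) (x : ℝ) : ℝ :=
  if x ≤ (p : ℝ) / q then 0
  else if x ≤ ((p : ℝ) + (2:ℝ) ^ (-(q:ℤ))) / q then (2:ℝ) ^ q * (x - (p : ℝ) / q)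
  else 1 / q

/-- `α_q(x) = ∑_{p=0}^{q-1} β_{p,q}(x)`. -/
noncomputable def alpha (q : ℕ) (x : ℝ) : ℝ := ∑ p ∈ Finset.range q, beta p q x

/-- `F(x) = ∑_{q=1}^∞ (1/q²)·α_q(x)`. -/
noncomputable def F (x : ℝ) : ℝ := ∑' q : ℕ, (1 / ((q:ℝ) + 1) ^ 2) * alpha (q + 1) x

theorem beta_eq_min_max (p : ℕ) {q : ℕ} (hq : 0 < q) (x : ℝ) :
    beta p q x = min (max ((2:ℝ) ^ q * (x - (p : ℝ) / q)) 0) (1 / q) := by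
  have hq' : (0:ℝ) < q := by exact_mod_cast hq
  have h2 : (0:ℝ) < 2 ^ q := by positivity
  have hinv : (0:ℝ) < 1 / q := by positivity
  have hsplit : ((p : ℝ) + (2:ℝ) ^ (-(q:ℤ))) / q = (p : ℝ) / q + ((2:ℝ) ^ q)⁻¹ * (1 / q) := by
    rw [zpow_neg, zpow_natCast]
    ring
  have hcancel : (2:ℝ) ^ q * (((2:ℝ) ^ q)⁻¹ * (1 / q)) = 1 / q := by
    rw [← mul_assoc, mul_inv_cancel₀ h2.ne', one_mul]
  unfold beta
  rw [hsplit]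
  split_ifs with h₁ h₂
  · rw [max_eq_right (mul_nonpos_of_nonneg_of_nonpos h2.le (by linarith)), min_eq_left hinv.le]
  · push Not at h₁
    have := mul_le_mul_of_nonneg_left (show x - (p : ℝ) / q ≤ ((2:ℝ) ^ q)⁻¹ * (1 / q) by linarith)
      h2.le
    rw [max_eq_left (mul_nonneg h2.le (by linarith)), min_eq_left (by linarith)]
  · push Not at h₂
    have := mul_le_mul_of_nonneg_left (show ((2:ℝ) ^ q)⁻¹ * (1 / q) ≤ x - (p : ℝ) / q by linarith)
      h2.le
    rw [min_eq_right (le_max_of_le_left (by linarith))]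

theorem abs_beta_sub_le (p : ℕ) {q : ℕ} (hq : 0 < q) (x y : ℝ) :
    |beta p q x - beta p q y| ≤ 2 ^ q * |x - y| := by
  rw [beta_eq_min_max p hq, beta_eq_min_max p hq]
  refine (abs_min_sub_min_le_max _ _ _ _).trans (max_le ?_ (by simp))
  refine (abs_max_sub_max_le_max _ _ _ _).trans (max_le ?_ (by simp))
  rw [← mul_sub, sub_sub_sub_cancel_right, abs_mul, abs_of_pos (by positivity)]

theorem abs_alpha_sub_le_mul {q : ℕ} (hq : 0 < q) (x y : ℝ) :
    |alpha q x - alpha q y| ≤ q * (2 ^ q * |x - y|) := by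
  unfold alpha
  rw [← Finset.sum_sub_distrib]
  refine (Finset.abs_sum_le_sum_abs _ _).trans ?_
  refine (Finset.sum_le_sum fun p _ => abs_beta_sub_le p hq x y).trans ?_
  simp

theorem le_alpha {q : ℕ} (hq : 0 < q) {x : ℝ} (hx : x ∈ Set.Icc (0:ℝ) 1) : x ≤ alpha q x := by
  have hq' : (0:ℝ) < q := by exact_mod_cast hq
  have htel := Finset.sum_range_sub (fun p : ℕ => min x ((p : ℝ) / q)) q
  have hsum : ∑ p ∈ Finset.range q, (min x (((p + 1 : ℕ) : ℝ) / q) - min x ((p : ℝ) / q))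
      ≤ alpha q x := by
    refine Finset.sum_le_sum fun p _ => ?_
    have hinv : (0:ℝ) < 1 / q := by positivity
    have hstep : ((p + 1 : ℕ) : ℝ) / q = (p : ℝ) / q + 1 / q := by push_cast; ring
    rw [beta_eq_min_max p hq, hstep]
    refine le_min ?_ ?_
    · rcases le_total x ((p : ℝ) / q) with h | h
      · rw [min_eq_left h, min_eq_left (by linarith), sub_self]
        exact le_max_right _ _
      · rw [min_eq_right h]
        have h1 : (1:ℝ) ≤ 2 ^ q := one_le_pow₀ (by norm_num)
        have h2 := min_le_left x ((p : ℝ) / q + 1 / q)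
        refine le_max_of_le_left ?_
        nlinarith
    · rcases le_total x ((p : ℝ) / q) with h | h
      · rw [min_eq_left h, min_eq_left (by linarith), sub_self]
        exact hinv.le
      · rw [min_eq_right h]
        linarith [min_le_right x ((p : ℝ) / q + 1 / q)]
  rw [htel, div_self hq'.ne'] at hsum
  simpa [hx.1, hx.2] using hsum

theorem alpha_le {q : ℕ} (hq : 0 < q) {x : ℝ} (hx : x ∈ Set.Icc (0:ℝ) 1) :
    alpha q x ≤ x + 1 / q := by
  have hq' : (0:ℝ) < q := by exact_mod_cast hq
  have hinv : (0:ℝ) < 1 / q := by positivity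
  have htel := Finset.sum_range_sub (fun p : ℕ => min x ((p : ℝ) / q - 1 / q)) q
  have hsum : alpha q x ≤ ∑ p ∈ Finset.range q,
      (min x (((p + 1 : ℕ) : ℝ) / q - 1 / q) - min x ((p : ℝ) / q - 1 / q)) := by
    refine Finset.sum_le_sum fun p _ => ?_
    have hstep : ((p + 1 : ℕ) : ℝ) / q - 1 / q = (p : ℝ) / q := by push_cast; ring
    rw [beta_eq_min_max p hq, hstep]
    rcases le_total x ((p : ℝ) / q) with h | h
    · rw [max_eq_right (mul_nonpos_of_nonneg_of_nonpos (by positivity) (by linarith)),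
        min_eq_left hinv.le, min_eq_left h]
      linarith [min_le_left x ((p : ℝ) / q - 1 / q)]
    · rw [min_eq_right h, min_eq_right (a := x) (by linarith)]
      linarith [min_le_right (max ((2:ℝ) ^ q * (x - (p : ℝ) / q)) 0) (1 / q)]
  rw [htel] at hsum
  have h0 : min x (((0 : ℕ) : ℝ) / q - 1 / q) = -(1 / q) := by
    rw [Nat.cast_zero, zero_div, zero_sub]
    exact min_eq_right (by linarith [hx.1])
  rw [h0] at hsum
  linarith [min_le_left x ((q : ℝ) / q - 1 / q)]

theorem abs_alpha_sub_le_add {q : ℕ} (hq : 0 < q) {x y : ℝ} (hx : x ∈ Set.Icc (0:ℝ) 1)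
    (hy : y ∈ Set.Icc (0:ℝ) 1) : |alpha q x - alpha q y| ≤ |x - y| + 1 / q := by
  have := le_alpha hq hx
  have := le_alpha hq hy
  have := alpha_le hq hx
  have := alpha_le hq hy
  rw [abs_le]
  constructor <;> linarith [le_abs_self (x - y), neg_abs_le (x - y)]

theorem summable_F {x : ℝ} (hx : x ∈ Set.Icc (0:ℝ) 1) :
    Summable fun q : ℕ => (1 / ((q:ℝ) + 1) ^ 2) * alpha (q + 1) x := by
  have hs : Summable fun q : ℕ => (1 / ((q:ℝ) + 1) ^ 2) * 2 := by
    have := (summable_nat_add_iff 1).2 (Real.summable_one_div_nat_pow.2 (by norm_num : 1 < 2))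
    simpa using this.mul_right 2
  refine Summable.of_nonneg_of_le (fun q => ?_) (fun q => ?_) hs
  · have := le_alpha q.succ_pos hx
    exact mul_nonneg (by positivity) (hx.1.trans this)
  · refine mul_le_mul_of_nonneg_left ?_ (by positivity)
    have h := alpha_le q.succ_pos hx
    have h1 : (1:ℝ) / ((q + 1 : ℕ) : ℝ) ≤ 1 := by
      rw [div_le_one (by positivity)]
      push_cast
      linarith [q.cast_nonneg (α := ℝ)]
    linarith [hx.2]

theorem sum_head_le (Q : ℕ) (x y : ℝ) :
    ∑ q ∈ Finset.range Q, (1 / ((q:ℝ) + 1) ^ 2) * |alpha (q + 1) x - alpha (q + 1) y|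
      ≤ 2 * 2 ^ Q * |x - y| := by
  induction Q with
  | zero => simp
  | succ q ih =>
    rw [Finset.sum_range_succ]
    have h := abs_alpha_sub_le_mul q.succ_pos x y
    have hw : (1 / ((q:ℝ) + 1) ^ 2) * |alpha (q + 1) x - alpha (q + 1) y|
        ≤ 2 ^ (q + 1) * |x - y| := by
      rw [one_div, inv_mul_le_iff₀ (by positivity)]
      refine h.trans (mul_le_mul_of_nonneg_right ?_ (by positivity))
      push_cast
      nlinarith [q.cast_nonneg (α := ℝ)]
    rw [pow_succ (2:ℝ) q] at hw ⊢
    linarith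

theorem sum_range_add_le {Q : ℕ} (hQ : 0 < Q) {x y : ℝ} (hx : x ∈ Set.Icc (0:ℝ) 1)
    (hy : y ∈ Set.Icc (0:ℝ) 1) (m : ℕ) :
    ∑ q ∈ Finset.range (Q + m), (1 / ((q:ℝ) + 1) ^ 2) * |alpha (q + 1) x - alpha (q + 1) y|
      ≤ 2 * 2 ^ Q * |x - y| + (|x - y| + 1 / Q) * (1 / Q - 1 / ((Q:ℝ) + m)) := by
  have hQ' : (0:ℝ) < Q := by exact_mod_cast hQ
  induction m with
  | zero => simpa using sum_head_le Q x y
  | succ m ih =>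
    rw [← add_assoc, Finset.sum_range_succ]
    have hm : (0:ℝ) ≤ m := m.cast_nonneg
    have h := abs_alpha_sub_le_add (Q + m).succ_pos hx hy
    have h1 : (1:ℝ) / ((Q + m + 1 : ℕ) : ℝ) ≤ 1 / Q := by
      apply one_div_le_one_div_of_le hQ'
      push_cast
      linarith
    have hw : 1 / (((Q + m : ℕ) : ℝ) + 1) ^ 2 ≤ 1 / ((Q:ℝ) + m) - 1 / ((Q:ℝ) + (m + 1 : ℕ)) := by
      push_cast
      have hpos : (0:ℝ) < (Q:ℝ) + m := by linarith
      rw [div_sub_div _ _ hpos.ne' (by positivity), div_le_div_iff₀ (by positivity) (by positivity)]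
      nlinarith
    have hmul := mul_le_mul hw (h.trans (by linarith : _ ≤ |x - y| + 1 / Q)) (abs_nonneg _)
      (le_trans (by positivity) hw)
    linarith

theorem abs_F_sub_le {Q : ℕ} (hQ : 0 < Q) {x y : ℝ} (hx : x ∈ Set.Icc (0:ℝ) 1)
    (hy : y ∈ Set.Icc (0:ℝ) 1) :
    |F x - F y| ≤ 2 * 2 ^ Q * |x - y| + (|x - y| + 1 / Q) * (1 / Q) := by
  have hF := ((summable_F hx).hasSum.sub (summable_F hy).hasSum).tendsto_sum_nat
  have hF' := ((Filter.tendsto_add_atTop_iff_nat Q).2 hF).abs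
  refine le_of_tendsto' hF' fun m => ?_
  rw [add_comm m Q]
  refine (Finset.abs_sum_le_sum_abs _ _).trans ?_
  have h := sum_range_add_le hQ hx hy m
  have hpos : 0 ≤ (|x - y| + 1 / Q) * (1 / ((Q:ℝ) + m)) := by positivity
  refine le_trans (le_of_eq (Finset.sum_congr rfl fun q _ => ?_)) (h.trans (by linarith))
  rw [← mul_sub, abs_mul, abs_of_nonneg (a := 1 / ((q:ℝ) + 1) ^ 2) (by positivity)]

theorem sq_le_two_pow {n : ℕ} (hn : 4 ≤ n) : n ^ 2 ≤ 2 ^ n := by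
  induction n, hn using Nat.le_induction with
  | base => norm_num
  | succ n hn ih =>
    rw [pow_succ 2]
    nlinarith

theorem F_exponential_modulus :
    ∃ N : ℕ, ∀ n : ℕ, N ≤ n → ∀ x ∈ Set.Icc (0:ℝ) 1, ∀ y ∈ Set.Icc (0:ℝ) 1,
      |x - y| ≤ ((2:ℝ) ^ (2 ^ n))⁻¹ → |F x - F y| ≤ ((2:ℝ) ^ n)⁻¹ := by
  refine ⟨4, fun n hn x hx y hy hxy => ?_⟩
  obtain ⟨k, rfl⟩ : ∃ k, n = k + 1 := ⟨n - 1, by omega⟩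
  obtain ⟨Q, hQ⟩ : ∃ Q : ℕ, Q = 2 ^ k := ⟨_, rfl⟩
  have hQ8 : 8 ≤ Q := by
    rw [hQ]
    exact Nat.pow_le_pow_right (n := 2) (by norm_num) (show 3 ≤ k by omega)
  have hQR : (8:ℝ) ≤ Q := by exact_mod_cast hQ8
  have hgoal : ((2:ℝ) ^ (k + 1))⁻¹ = (1 / Q) / 2 := by
    rw [hQ, pow_succ]
    push_cast
    field_simp
  have hpow : (2:ℝ) ^ (2 ^ (k + 1)) = 2 ^ Q * 2 ^ Q := by
    rw [← pow_add, hQ, pow_succ, mul_two]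
  have hsq : (Q:ℝ) ^ 2 ≤ 2 ^ Q := by exact_mod_cast sq_le_two_pow (by omega : 4 ≤ Q)
  have hP : (0:ℝ) < 2 ^ Q := by positivity
  rw [hpow, mul_inv] at hxy
  rw [hgoal]
  refine (abs_F_sub_le (by omega : 0 < Q) hx hy).trans ?_
  have hu : ((2:ℝ) ^ Q)⁻¹ ≤ (1 / Q) ^ 2 := by
    rw [one_div, inv_pow]
    exact inv_anti₀ (by positivity) hsq
  have hr : (1:ℝ) / Q ≤ 1 / 8 := one_div_le_one_div_of_le (by norm_num) hQR
  have hr0 : (0:ℝ) < 1 / Q := by positivity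
  have hu0 : 0 < ((2:ℝ) ^ Q)⁻¹ := by positivity
  have hhead : 2 * 2 ^ Q * |x - y| ≤ 2 * ((2:ℝ) ^ Q)⁻¹ := by
    have := mul_le_mul_of_nonneg_left hxy hP.le
    rw [← mul_assoc, mul_inv_cancel₀ hP.ne', one_mul] at this
    linarith
  generalize (1:ℝ) / Q = r at *
  generalize ((2:ℝ) ^ Q)⁻¹ = u at *
  have hur : u ≤ r := by nlinarith
  have hd : |x - y| ≤ r := by nlinarith
  nlinarith
end

section
/- Every modulus of continuity of F at a rational point grows exponentially: if x = a/b with natural numbers a, b satisfying b ≥ 1 and 0 < a/b < 1, and ω : ℕ → ℕ is such that for all n ∈ ℕ and all y ∈ [0,1], |y − x| ≤ 2^{−ω(n)} implies |F(y) − F(x)| ≤ 2^{−n}, then for every n ∈ ℕ it holds that b³·(max(ω(n), 1))³ ≥ 2^n. -/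
open scoped BigOperators

theorem beta_eq_max_min (p : ℕ) {q : ℕ} (hq : 0 < q) (x : ℝ) :
    beta p q x = max 0 (min (1 / (q : ℝ)) ((2 : ℝ) ^ q * (x - (p : ℝ) / q))) := by
  have hq' : (0 : ℝ) < q := by exact_mod_cast hq
  have h2 : (0 : ℝ) < 2 ^ q := by positivity
  have hcut : (2 : ℝ) ^ q * (((p : ℝ) + (2 : ℝ) ^ (-(q : ℤ))) / q - (p : ℝ) / q) = 1 / q := by
    rw [zpow_neg, zpow_natCast]
    field_simp
    ring
  unfold beta
  split_ifs with hx hxc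
  · have : (2 : ℝ) ^ q * (x - (p : ℝ) / q) ≤ 0 :=
      mul_nonpos_of_nonneg_of_nonpos h2.le (sub_nonpos.2 hx)
    rw [max_eq_left ((min_le_right _ _).trans this)]
  · have hle : (2 : ℝ) ^ q * (x - (p : ℝ) / q) ≤ 1 / q := by
      rw [← hcut]
      gcongr
    have hnonneg : 0 ≤ (2 : ℝ) ^ q * (x - (p : ℝ) / q) :=
      mul_nonneg h2.le (sub_nonneg.2 (not_le.1 hx).le)
    rw [min_eq_right hle, max_eq_right hnonneg]
  · have hle : 1 / (q : ℝ) ≤ (2 : ℝ) ^ q * (x - (p : ℝ) / q) := by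
      rw [← hcut]
      gcongr
      exact (not_le.1 hxc).le
    rw [min_eq_left hle, max_eq_right (by positivity)]

theorem beta_nonneg (p : ℕ) {q : ℕ} (hq : 0 < q) (x : ℝ) : 0 ≤ beta p q x := by
  rw [beta_eq_max_min p hq]
  exact le_max_left _ _

theorem beta_le (p : ℕ) {q : ℕ} (hq : 0 < q) (x : ℝ) : beta p q x ≤ 1 / q := by
  rw [beta_eq_max_min p hq]
  exact max_le (by positivity) (min_le_left _ _)

theorem beta_monotone (p : ℕ) {q : ℕ} (hq : 0 < q) : Monotone (beta p q) := by
  intro x y hxy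
  rw [beta_eq_max_min p hq, beta_eq_max_min p hq]
  gcongr

theorem alpha_nonneg {q : ℕ} (hq : 0 < q) (x : ℝ) : 0 ≤ alpha q x :=
  Finset.sum_nonneg fun p _ => beta_nonneg p hq x

theorem alpha_le_one {q : ℕ} (hq : 0 < q) (x : ℝ) : alpha q x ≤ 1 := by
  have hq' : (q : ℝ) ≠ 0 := by exact_mod_cast hq.ne'
  calc alpha q x ≤ ∑ _p ∈ Finset.range q, 1 / (q : ℝ) :=
        Finset.sum_le_sum fun p _ => beta_le p hq x
    _ = 1 := by simp [hq']

theorem alpha_monotone {q : ℕ} (hq : 0 < q) : Monotone (alpha q) := fun _ _ hxy =>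
  Finset.sum_le_sum fun p _ => beta_monotone p hq hxy

theorem beta_sub_le_alpha_sub {p q : ℕ} (hpq : p < q) {x y : ℝ} (hxy : x ≤ y) :
    beta p q y - beta p q x ≤ alpha q y - alpha q x := by
  unfold alpha
  rw [← Finset.sum_sub_distrib]
  exact Finset.single_le_sum (f := fun p => beta p q y - beta p q x)
    (fun i _ => sub_nonneg.2 (beta_monotone i (by omega) hxy)) (Finset.mem_range.2 hpq)

theorem summable_F_terms (x : ℝ) :
    Summable fun q : ℕ => (1 / ((q : ℝ) + 1) ^ 2) * alpha (q + 1) x := by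
  have hsq : Summable fun q : ℕ => 1 / ((q : ℝ) + 1) ^ 2 := by
    have := (summable_nat_add_iff 1).2 (Real.summable_one_div_nat_pow.2 one_lt_two)
    simpa using this
  refine hsq.of_nonneg_of_le (fun q => ?_) fun q => ?_
  · exact mul_nonneg (by positivity) (alpha_nonneg q.succ_pos x)
  · exact mul_le_of_le_one_right (by positivity) (alpha_le_one q.succ_pos x)

theorem alpha_sub_le_F_sub {q : ℕ} (hq : 0 < q) {x y : ℝ} (hxy : x ≤ y) :
    1 / (q : ℝ) ^ 2 * (alpha q y - alpha q x) ≤ F y - F x := by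
  obtain ⟨k, rfl⟩ := Nat.exists_eq_succ_of_ne_zero hq.ne'
  unfold F
  rw [← (summable_F_terms y).tsum_sub (summable_F_terms x)]
  refine le_trans (le_of_eq ?_)
    (((summable_F_terms y).sub (summable_F_terms x)).le_tsum k fun j _ => ?_)
  · push_cast
    ring
  · rw [← mul_sub]
    exact mul_nonneg (by positivity) (sub_nonneg.2 (alpha_monotone j.succ_pos hxy))

/-- On the interval where `beta p q` rises, `F` grows by at least `1 / q ^ 3`. -/
theorem one_div_cube_le_F_sub {p q : ℕ} (hpq : p < q) :
    1 / (q : ℝ) ^ 3 ≤ F ((p : ℝ) / q + ((2 : ℝ) ^ q)⁻¹ / q) - F ((p : ℝ) / q) := by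
  have hq : 0 < q := by omega
  have hq' : (0 : ℝ) < q := by exact_mod_cast hq
  have hxy : (p : ℝ) / q ≤ (p : ℝ) / q + ((2 : ℝ) ^ q)⁻¹ / q :=
    le_add_of_nonneg_right (by positivity)
  have hleft : beta p q ((p : ℝ) / q) = 0 := by simp [beta]
  have hright : beta p q ((p : ℝ) / q + ((2 : ℝ) ^ q)⁻¹ / q) = 1 / q := by
    have hrise : (2 : ℝ) ^ q * ((p : ℝ) / q + ((2 : ℝ) ^ q)⁻¹ / q - (p : ℝ) / q) = 1 / q := by
      field_simp
      ring
    rw [beta_eq_max_min p hq, hrise, min_self, max_eq_right (by positivity)]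
  calc 1 / (q : ℝ) ^ 3 = 1 / (q : ℝ) ^ 2 * (1 / q - 0) := by field_simp; ring
    _ ≤ 1 / (q : ℝ) ^ 2 * _ := by
        rw [← hleft, ← hright]
        exact mul_le_mul_of_nonneg_left (beta_sub_le_alpha_sub hpq hxy) (by positivity)
    _ ≤ _ := alpha_sub_le_F_sub hq hxy

theorem pointwise_modulus_grows_exponentially (a b : ℕ) (hb : 1 ≤ b)
    (h0 : 0 < (a : ℝ) / b) (h1 : (a : ℝ) / b < 1) (ω : ℕ → ℕ)
    (hω : ∀ n : ℕ, ∀ y ∈ Set.Icc (0:ℝ) 1,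
      |y - (a : ℝ) / b| ≤ ((2:ℝ) ^ (ω n))⁻¹ → |F y - F ((a : ℝ) / b)| ≤ ((2:ℝ) ^ n)⁻¹) :
    ∀ n : ℕ, 2 ^ n ≤ b ^ 3 * (max (ω n) 1) ^ 3 := by
  intro n
  set m := max (ω n) 1
  have hm : 0 < m := lt_of_lt_of_le one_pos (le_max_right _ _)
  have hb' : (0 : ℝ) < b := by exact_mod_cast hb
  have hm' : (0 : ℝ) < m := by exact_mod_cast hm
  have hab : a < b := by
    rw [div_lt_one hb'] at h1
    exact_mod_cast h1
  have hpq : a * m < b * m := Nat.mul_lt_mul_of_pos_right hab hm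
  have hq1 : 1 ≤ b * m := by omega
  have hωq : ω n ≤ b * m := (le_max_left _ _).trans (Nat.le_mul_of_pos_left m hb)
  have hx : ((a * m : ℕ) : ℝ) / ((b * m : ℕ) : ℝ) = (a : ℝ) / b := by
    push_cast
    exact mul_div_mul_right _ _ hm'.ne'
  have hgrow := one_div_cube_le_F_sub hpq
  generalize hq : b * m = q at *
  have hq1' : (1 : ℝ) ≤ q := by exact_mod_cast hq1
  have hpq' : ((a * m : ℕ) : ℝ) + 1 ≤ q := by exact_mod_cast hpq
  have hstep : 0 ≤ ((2 : ℝ) ^ q)⁻¹ / q := by positivity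
  have hmem : (a : ℝ) / b + ((2 : ℝ) ^ q)⁻¹ / q ∈ Set.Icc (0 : ℝ) 1 := by
    refine ⟨by positivity, ?_⟩
    rw [← hx, ← add_div, div_le_one (by positivity)]
    have : ((2 : ℝ) ^ q)⁻¹ ≤ 1 := inv_le_one_of_one_le₀ (one_le_pow₀ one_le_two)
    linarith
  have hclose : |(a : ℝ) / b + ((2 : ℝ) ^ q)⁻¹ / q - (a : ℝ) / b| ≤ ((2 : ℝ) ^ (ω n))⁻¹ := by
    rw [add_sub_cancel_left, abs_of_nonneg hstep]
    refine (div_le_self (by positivity) hq1').trans ?_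
    gcongr
    exact one_le_two
  have hsmall := (le_abs_self _).trans (hω n _ hmem hclose)
  rw [hx] at hgrow
  have hinv : ((q : ℝ) ^ 3)⁻¹ ≤ ((2 : ℝ) ^ n)⁻¹ := by
    rw [← one_div]
    exact hgrow.trans hsmall
  rw [inv_le_inv₀ (by positivity) (by positivity)] at hinv
  rw [← mul_pow, hq]
  exact_mod_cast hinv
end
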